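/- Let Σ_Λ = {Σ_λ = (γ_λ,f_λ,g_λ)}_{λ∈Λ} and h⁰, h ∈ H satisfy Assumption 1 with φ_λ(t,r) = p_λ(t)·r, where each p_λ : [0,∞) → R is Lebesgue measurable and locally integrable, and with α_λ(t,r) = d·r for a constant d ≥ 0. Suppose there exist κ > 0 and c ∈ R such that for all λ ∈ Λ every solution of the linear equation ẇ = −p_λ(t)w satisfies |w(t)| ≤ κ e^{−c(t−t_0)} |w(t_0)| for all t ≥ t_0 ≥ 0. If c ≤ 0, d < 1 and Γ_Λ = {γ_λ : λ ∈ Λ} ⊂ Γ_RADT[N_0,τ_D] for some N_0 ∈ N and some 0 < τ_D < |ln(d)/c| (any τ_D > 0 being admissible when c·d = 0, using the conventions 0·ln(0) = 0 and r·ln(0) = −∞ for r > 0), then Σ_Λ is strongly (h⁰,h)-ISS. -/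

import Mathlib

open MeasureTheory Filter Set
open scoped Classical

noncomputable section

/-- State/input spaces: `ℝ^k` with the Euclidean norm. -/
abbrev Stt (k : ℕ) : Type := EuclideanSpace ℝ (Fin k)

/-- An impulse-time sequence, identified with its (locally finite) set of impulse
times, a subset of `(0,∞)` with finitely many points below any bound. -/
def IsImpulseSeq (γ : Set ℝ) : Prop :=
  γ ⊆ Set.Ioi (0 : ℝ) ∧ ∀ T : ℝ, (γ ∩ Set.Iic T).Finite

/-- `n^γ_{(s,t]}`: the number of impulse times in the interval `(s,t]`. -/
def nJumps (γ : Set ℝ) (s t : ℝ) : ℕ := (γ ∩ Set.Ioc s t).ncard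

/-- Uniform incremental boundedness of a set of impulse-time sequences. -/
def UIB (S : Set (Set ℝ)) : Prop :=
  ∃ φ : ℝ → ℝ, ContinuousOn φ (Set.Ici 0) ∧ MonotoneOn φ (Set.Ici 0) ∧
    (∀ s : ℝ, 0 ≤ s → 0 ≤ φ s) ∧
    ∀ γ ∈ S, ∀ t0 t : ℝ, 0 ≤ t0 → t0 < t → (nJumps γ t0 t : ℝ) ≤ φ (t - t0)

/-- Class `K∞` functions `[0,∞) → [0,∞)`. -/
def ClassKInf (α : ℝ → ℝ) : Prop :=
  ContinuousOn α (Set.Ici 0) ∧ StrictMonoOn α (Set.Ici 0) ∧ α 0 = 0 ∧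
    ∀ M : ℝ, ∃ r : ℝ, 0 ≤ r ∧ M ≤ α r

/-- Class `KL` functions. -/
def ClassKL (β : ℝ → ℝ → ℝ) : Prop :=
  (∀ t : ℝ, 0 ≤ t → ClassKInf fun r => β r t) ∧
  ∀ r : ℝ, 0 ≤ r → AntitoneOn (fun t => β r t) (Set.Ici 0) ∧
    Filter.Tendsto (fun t => β r t) Filter.atTop (nhds 0)

/-- Positive definite functions `[0,∞) → [0,∞)`. -/
def PosDef (ρ : ℝ → ℝ) : Prop :=
  ContinuousOn ρ (Set.Ici 0) ∧ ρ 0 = 0 ∧ ∀ r : ℝ, 0 < r → 0 < ρ r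

/-- Locally integrable (on compacts) function `[0,∞) → ℝ` (extended to `ℝ`). -/
def LocIntegrable (p : ℝ → ℝ) : Prop :=
  ∀ a b : ℝ, MeasureTheory.IntegrableOn p (Set.Icc a b)

/-- Inputs: measurable, locally essentially bounded functions. -/
def IsInput {m : ℕ} (u : ℝ → Stt m) : Prop :=
  Measurable u ∧ ∀ T : ℝ, ∃ C : ℝ, ∀ᵐ t ∂MeasureTheory.volume, t ∈ Set.Icc 0 T → ‖u t‖ ≤ C

/-- `‖u_I‖_γ`: max of the essential supremum of `‖u‖` over `I` and the supremum of
`‖u‖` over `γ ∩ I`. -/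
def inputNorm {m : ℕ} (γ : Set ℝ) (u : ℝ → Stt m) (I : Set ℝ) : ℝ :=
  max (essSup (fun t => ‖u t‖) (MeasureTheory.volume.restrict I))
      (sSup ((fun t => ‖u t‖) '' (γ ∩ I)))

/-- Solution of the impulsive system `(γ,f,g)` on `[t0,T)` with initial state `x0`
and input `u` (Carathéodory solutions, in integral form, between impulses). -/
structure IsSolution {n m : ℕ} (γ : Set ℝ) (f g : ℝ → Stt n → Stt m → Stt n)
    (t0 : ℝ) (x0 : Stt n) (u : ℝ → Stt m) (T : EReal) (x : ℝ → Stt n) : Prop where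
  lt : (t0 : EReal) < T
  init : x t0 = x0
  flow : ∀ t1 t2 : ℝ, t0 ≤ t1 → t1 ≤ t2 → (t2 : EReal) < T → Set.Ioc t1 t2 ∩ γ = ∅ →
    MeasureTheory.IntegrableOn (fun s => f s (x s) (u s)) (Set.Icc t1 t2) ∧
    x t2 = x t1 + ∫ s in t1..t2, f s (x s) (u s)
  jump : ∀ t ∈ γ, t0 < t → (t : EReal) < T →
    ∃ L : Stt n, Filter.Tendsto x (nhdsWithin t (Set.Iio t)) (nhds L) ∧
      x t = L + g t L (u t)

/-- Maximally defined solution. -/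
def IsMaxSolution {n m : ℕ} (γ : Set ℝ) (f g : ℝ → Stt n → Stt m → Stt n)
    (t0 : ℝ) (x0 : Stt n) (u : ℝ → Stt m) (T : EReal) (x : ℝ → Stt n) : Prop :=
  IsSolution γ f g t0 x0 u T x ∧
    ∀ (T' : EReal) (x' : ℝ → Stt n), IsSolution γ f g t0 x0 u T' x' →
      (∀ t : ℝ, t0 ≤ t → (t : EReal) < T → x' t = x t) → T' ≤ T

/-- Weak `(h⁰,h)`-ISS of a parametrized family of impulsive systems. -/
def WeaklyISS {n m : ℕ} {Λ : Type*} (γ : Λ → Set ℝ)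
    (f g : Λ → ℝ → Stt n → Stt m → Stt n) (h0 h : ℝ → Stt n → ℝ) : Prop :=
  ∃ β : ℝ → ℝ → ℝ, ∃ ρ : ℝ → ℝ, ClassKL β ∧ ClassKInf ρ ∧
    ∀ (l : Λ) (t0 : ℝ) (x0 : Stt n) (u : ℝ → Stt m) (T : EReal) (x : ℝ → Stt n),
      0 ≤ t0 → IsInput u → IsMaxSolution (γ l) (f l) (g l) t0 x0 u T x →
      ∀ t : ℝ, t0 ≤ t → (t : EReal) < T →
        h t (x t) ≤ β (h0 t0 x0) (t - t0) + ρ (inputNorm (γ l) u (Set.Ioc t0 t))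

/-- Strong `(h⁰,h)`-ISS of a parametrized family of impulsive systems. -/
def StronglyISS {n m : ℕ} {Λ : Type*} (γ : Λ → Set ℝ)
    (f g : Λ → ℝ → Stt n → Stt m → Stt n) (h0 h : ℝ → Stt n → ℝ) : Prop :=
  ∃ β : ℝ → ℝ → ℝ, ∃ ρ : ℝ → ℝ, ClassKL β ∧ ClassKInf ρ ∧
    ∀ (l : Λ) (t0 : ℝ) (x0 : Stt n) (u : ℝ → Stt m) (T : EReal) (x : ℝ → Stt n),
      0 ≤ t0 → IsInput u → IsMaxSolution (γ l) (f l) (g l) t0 x0 u T x →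
      ∀ t : ℝ, t0 ≤ t → (t : EReal) < T →
        h t (x t) ≤ β (h0 t0 x0) (t - t0 + (nJumps (γ l) t0 t : ℝ)) +
          ρ (inputNorm (γ l) u (Set.Ioc t0 t))

/-- Locally Lipschitz on a set. -/
def LocLipschitzOn {α β : Type*} [PseudoEMetricSpace α] [PseudoEMetricSpace β]
    (s : Set α) (f : α → β) : Prop :=
  ∀ x ∈ s, ∃ K : NNReal, ∃ t ∈ nhdsWithin x s, LipschitzOnWith K f t

/-- `V ∈ V(γ)` with `Vm` its left-limit function at impulse times: `V` is locally
Lipschitz on each inter-impulse strip and has the joint left limit `Vm τ ξ`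
at each `τ ∈ γ`. -/
def InClassV {n : ℕ} (γ : Set ℝ) (V Vm : ℝ → Stt n → ℝ) : Prop :=
  (∀ a b : ℝ, 0 ≤ a → Set.Ioo a b ∩ γ = ∅ →
    LocLipschitzOn (Set.Ico a b ×ˢ (Set.univ : Set (Stt n)))
      (fun q : ℝ × Stt n => V q.1 q.2)) ∧
  ∀ τ ∈ γ, ∀ ξ : Stt n,
    Filter.Tendsto (fun q : ℝ × Stt n => V q.1 q.2)
      (nhdsWithin (τ, ξ) (Set.Iio τ ×ˢ (Set.univ : Set (Stt n)))) (nhds (Vm τ ξ))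

/-- Upper-right Dini derivative of `V` along the flow map `f`. -/
def DiniAlong {n m : ℕ} (f : ℝ → Stt n → Stt m → Stt n) (V : ℝ → Stt n → ℝ)
    (t : ℝ) (ξ : Stt n) (μ : Stt m) : ℝ :=
  Filter.limsup (fun d : ℝ => (V (t + d) (ξ + d • f t ξ μ) - V t ξ) / d)
    (nhdsWithin 0 (Set.Ioi 0))

/-- Carathéodory function `[0,∞) × [0,∞) → ℝ`. -/
def Caratheodory2 (φ : ℝ → ℝ → ℝ) : Prop :=
  (∀ r : ℝ, Measurable fun t => φ t r) ∧
  (∀ t : ℝ, ContinuousOn (φ t) (Set.Ici 0)) ∧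
  ∀ a b c : ℝ, ∃ mK : ℝ → ℝ, MeasureTheory.IntegrableOn mK (Set.Icc a b) ∧
    ∀ t ∈ Set.Icc a b, ∀ r ∈ Set.Icc (0 : ℝ) c, |φ t r| ≤ mK t

/-- Assumption 1 of the paper, with all the data explicit. -/
def Assumption1 {n m : ℕ} {Λ : Type*} (γ : Λ → Set ℝ)
    (f g : Λ → ℝ → Stt n → Stt m → Stt n) (h0 h : ℝ → Stt n → ℝ)
    (V Vm : Λ → ℝ → Stt n → ℝ) (φ1 φ2 χ π : ℝ → ℝ)
    (vφ al : Λ → ℝ → ℝ → ℝ) : Prop :=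
  ClassKInf φ1 ∧ ClassKInf φ2 ∧ ClassKInf χ ∧ ClassKInf π ∧
  (∀ l : Λ, InClassV (γ l) (V l) (Vm l)) ∧
  (∀ l : Λ, Caratheodory2 (vφ l)) ∧
  (∀ (l : Λ) (t r : ℝ), 0 ≤ t → 0 ≤ r → 0 ≤ al l t r) ∧
  (∀ (l : Λ) (t : ℝ) (ξ : Stt n), 0 ≤ t →
    φ1 (h t ξ) ≤ V l t ξ ∧ V l t ξ ≤ φ2 (h0 t ξ)) ∧
  (∀ (l : Λ) (t : ℝ) (ξ : Stt n) (μ : Stt m), 0 ≤ t → t ∉ γ l → χ ‖μ‖ ≤ V l t ξ →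
    DiniAlong (f l) (V l) t ξ μ ≤ - vφ l t (V l t ξ)) ∧
  (∀ (l : Λ) (t : ℝ) (ξ : Stt n) (μ : Stt m), t ∈ γ l → χ ‖μ‖ ≤ Vm l t ξ →
    V l t (ξ + g l t ξ μ) ≤ al l t (Vm l t ξ)) ∧
  (∀ (l : Λ) (t : ℝ) (ξ : Stt n) (μ : Stt m), t ∈ γ l → Vm l t ξ ≤ χ ‖μ‖ →
    V l t (ξ + g l t ξ μ) ≤ π ‖μ‖)

/-- Solution of the scalar comparison differential/difference inclusion. -/
structure IsCompSol (γ : Set ℝ) (vφ al : ℝ → ℝ → ℝ) (t0 z0 : ℝ) (T : EReal)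
    (z : ℝ → ℝ) : Prop where
  lt : (t0 : EReal) < T
  init : z t0 = z0
  nonneg : ∀ t : ℝ, t0 ≤ t → (t : EReal) < T → 0 ≤ z t
  flow : ∀ t1 t2 : ℝ, t0 ≤ t1 → t1 ≤ t2 → (t2 : EReal) < T → Set.Ioc t1 t2 ∩ γ = ∅ →
    ∃ d : ℝ → ℝ, MeasureTheory.IntegrableOn d (Set.Icc t1 t2) ∧
      (∀ᵐ s ∂MeasureTheory.volume, s ∈ Set.Icc t1 t2 → d s ≤ - vφ s (z s)) ∧
      ∀ t ∈ Set.Icc t1 t2, z t = z t1 + ∫ s in t1..t, d s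
  jump : ∀ t ∈ γ, t0 < t → (t : EReal) < T →
    ∃ L : ℝ, Filter.Tendsto z (nhdsWithin t (Set.Iio t)) (nhds L) ∧ z t ≤ al t L

/-- The family of comparison systems is weakly GUAS. -/
def CompWeakGUAS {Λ : Type*} (γ : Λ → Set ℝ) (vφ al : Λ → ℝ → ℝ → ℝ) : Prop :=
  ∃ β : ℝ → ℝ → ℝ, ClassKL β ∧
    ∀ (l : Λ) (t0 z0 : ℝ) (T : EReal) (z : ℝ → ℝ), 0 ≤ t0 → 0 ≤ z0 →
      IsCompSol (γ l) (vφ l) (al l) t0 z0 T z →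
      ∀ t : ℝ, t0 ≤ t → (t : EReal) < T → z t ≤ β z0 (t - t0)

/-- The family of comparison systems is strongly GUAS. -/
def CompStrongGUAS {Λ : Type*} (γ : Λ → Set ℝ) (vφ al : Λ → ℝ → ℝ → ℝ) : Prop :=
  ∃ β : ℝ → ℝ → ℝ, ClassKL β ∧
    ∀ (l : Λ) (t0 z0 : ℝ) (T : EReal) (z : ℝ → ℝ), 0 ≤ t0 → 0 ≤ z0 →
      IsCompSol (γ l) (vφ l) (al l) t0 z0 T z →
      ∀ t : ℝ, t0 ≤ t → (t : EReal) < T → z t ≤ β z0 (t - t0 + (nJumps (γ l) t0 t : ℝ))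

/-- Nonnegative Carathéodory solution of the scalar ODE `ẇ = rhs(t,w)` on `[t0,T)`. -/
structure IsODESol (rhs : ℝ → ℝ → ℝ) (t0 : ℝ) (T : EReal) (w : ℝ → ℝ) : Prop where
  lt : (t0 : EReal) < T
  nonneg : ∀ t : ℝ, t0 ≤ t → (t : EReal) < T → 0 ≤ w t
  flow : ∀ t1 t2 : ℝ, t0 ≤ t1 → t1 ≤ t2 → (t2 : EReal) < T →
    IntervalIntegrable (fun s => rhs s (w s)) MeasureTheory.volume t1 t2 ∧
    w t2 = w t1 + ∫ s in t1..t2, rhs s (w s)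

/-- Maximally defined forward-in-time solution of `ẇ = rhs(t,w)`. -/
def IsMaxODESol (rhs : ℝ → ℝ → ℝ) (t0 : ℝ) (T : EReal) (w : ℝ → ℝ) : Prop :=
  IsODESol rhs t0 T w ∧
    ∀ (T' : EReal) (w' : ℝ → ℝ), IsODESol rhs t0 T' w' →
      (∀ t : ℝ, t0 ≤ t → (t : EReal) < T → w' t = w t) → T' ≤ T

/-- GUAS of the family of scalar ODEs `ẇ = −φ_λ(t,w)`. -/
def ODEFamilyGUAS {Λ : Type*} (vφ : Λ → ℝ → ℝ → ℝ) : Prop :=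
  ∃ β : ℝ → ℝ → ℝ, ClassKL β ∧
    ∀ (l : Λ) (t0 : ℝ) (T : EReal) (w : ℝ → ℝ), 0 ≤ t0 →
      IsMaxODESol (fun s r => -(vφ l s r)) t0 T w →
      T = (⊤ : EReal) ∧ ∀ t : ℝ, t0 ≤ t → w t ≤ β (w t0) (t - t0)

/-- Solution (on all of `[0,∞)`) of the scalar linear ODE `ẇ = −p(t)·w`. -/
def IsLinSol (p : ℝ → ℝ) (w : ℝ → ℝ) : Prop :=
  ∀ t1 t2 : ℝ, 0 ≤ t1 → t1 ≤ t2 →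
    IntervalIntegrable (fun s => p s * w s) MeasureTheory.volume t1 t2 ∧
    w t2 = w t1 + ∫ s in t1..t2, -(p s * w s)

/-- An impulsive and switching sequence, described through its impulse-time set,
its two switching signals (constant between impulses), and the left limit of the
first switching signal at impulse times. -/
structure SwSignal (Ic Id : Type*) where
  γ : Set ℝ
  σ1 : ℝ → Ic
  σ1m : ℝ → Ic
  σ2 : ℝ → Id
  impulse : IsImpulseSeq γ
  const1 : ∀ a b : ℝ, 0 ≤ a → Set.Ioo a b ∩ γ = ∅ → ∀ t ∈ Set.Ico a b, σ1 t = σ1 a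
  const2 : ∀ a b : ℝ, 0 ≤ a → Set.Ioo a b ∩ γ = ∅ → ∀ t ∈ Set.Ico a b, σ2 t = σ2 a
  leftlim : ∀ t ∈ γ, ∀ᶠ s in nhdsWithin t (Set.Iio t), σ1 s = σ1m t

/-- `σ ∈ SW(J)`. -/
def InSW {Ic Id : Type*} (σ : SwSignal Ic Id) (J : Set (Ic × Ic × Id)) : Prop :=
  ∀ t ∈ σ.γ, (σ.σ1m t, σ.σ1 t, σ.σ2 t) ∈ J

/-- Flow map of the switched impulsive system `Σ_σ`. -/
def swF {n m : ℕ} {Ic Id : Type*} (F : Ic → ℝ → Stt n → Stt m → Stt n)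
    (σ : SwSignal Ic Id) : ℝ → Stt n → Stt m → Stt n :=
  fun t ξ μ => F (σ.σ1 t) t ξ μ

/-- Jump map of the switched impulsive system `Σ_σ`. -/
def swG {n m : ℕ} {Ic Id : Type*} (G : Id → ℝ → Stt n → Stt m → Stt n)
    (σ : SwSignal Ic Id) : ℝ → Stt n → Stt m → Stt n :=
  fun t ξ μ => G (σ.σ2 t) t ξ μ

/-- Weak `(h⁰,h)`-ISS of the family `{Σ_σ}_{σ ∈ SW}`. -/
def SwWeaklyISS {n m : ℕ} {Ic Id : Type*} (F : Ic → ℝ → Stt n → Stt m → Stt n)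
    (G : Id → ℝ → Stt n → Stt m → Stt n) (SW : Set (SwSignal Ic Id))
    (h0 h : ℝ → Stt n → ℝ) : Prop :=
  ∃ β : ℝ → ℝ → ℝ, ∃ ρ : ℝ → ℝ, ClassKL β ∧ ClassKInf ρ ∧
    ∀ σ ∈ SW, ∀ (t0 : ℝ) (x0 : Stt n) (u : ℝ → Stt m) (T : EReal) (x : ℝ → Stt n),
      0 ≤ t0 → IsInput u → IsMaxSolution σ.γ (swF F σ) (swG G σ) t0 x0 u T x →
      ∀ t : ℝ, t0 ≤ t → (t : EReal) < T →
        h t (x t) ≤ β (h0 t0 x0) (t - t0) + ρ (inputNorm σ.γ u (Set.Ioc t0 t))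

/-- Strong `(h⁰,h)`-ISS of the family `{Σ_σ}_{σ ∈ SW}`. -/
def SwStronglyISS {n m : ℕ} {Ic Id : Type*} (F : Ic → ℝ → Stt n → Stt m → Stt n)
    (G : Id → ℝ → Stt n → Stt m → Stt n) (SW : Set (SwSignal Ic Id))
    (h0 h : ℝ → Stt n → ℝ) : Prop :=
  ∃ β : ℝ → ℝ → ℝ, ∃ ρ : ℝ → ℝ, ClassKL β ∧ ClassKInf ρ ∧
    ∀ σ ∈ SW, ∀ (t0 : ℝ) (x0 : Stt n) (u : ℝ → Stt m) (T : EReal) (x : ℝ → Stt n),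
      0 ≤ t0 → IsInput u → IsMaxSolution σ.γ (swF F σ) (swG G σ) t0 x0 u T x →
      ∀ t : ℝ, t0 ≤ t → (t : EReal) < T →
        h t (x t) ≤ β (h0 t0 x0) (t - t0 + (nJumps σ.γ t0 t : ℝ)) +
          ρ (inputNorm σ.γ u (Set.Ioc t0 t))

/-- Total activation time in `(t0,t]` of the flow modes in `A`. -/
def actT {Ic Id : Type*} (σ : SwSignal Ic Id) (A : Set Ic) (t0 t : ℝ) : ℝ :=
  (MeasureTheory.volume {r : ℝ | r ∈ Set.Ioc t0 t ∧ σ.σ1 r ∈ A}).toReal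

/-- Number of impulse times in `(t0,t]` whose mode combination lies in `Jp`. -/
def nJumpsIn {Ic Id : Type*} (σ : SwSignal Ic Id) (Jp : Set (Ic × Ic × Id))
    (t0 t : ℝ) : ℕ :=
  (σ.γ ∩ Set.Ioc t0 t ∩ {r : ℝ | (σ.σ1m r, σ.σ1 r, σ.σ2 r) ∈ Jp}).ncard

/-- Assumption 2 of the paper (for switched impulsive systems), data explicit. -/
def Assumption2 {n m : ℕ} {Ic Id : Type*}
    (F : Ic → ℝ → Stt n → Stt m → Stt n) (G : Id → ℝ → Stt n → Stt m → Stt n)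
    (h0 h : ℝ → Stt n → ℝ) (J : Set (Ic × Ic × Id))
    (v : Ic → ℝ → Stt n → ℝ) (φ1 φ2 χ π : ℝ → ℝ)
    (vφ : Ic → ℝ → ℝ → ℝ) (al : Ic × Ic × Id → ℝ → ℝ → ℝ) : Prop :=
  ClassKInf φ1 ∧ ClassKInf φ2 ∧ ClassKInf χ ∧ ClassKInf π ∧
  (∀ i : Ic, LocLipschitzOn ((Set.Ici (0 : ℝ)) ×ˢ (Set.univ : Set (Stt n)))
      (fun q : ℝ × Stt n => v i q.1 q.2)) ∧
  (∀ i : Ic, Caratheodory2 (vφ i)) ∧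
  (∀ e ∈ J, ∀ t r : ℝ, 0 ≤ t → 0 ≤ r → 0 ≤ al e t r) ∧
  (∀ (i : Ic) (t : ℝ) (ξ : Stt n), 0 ≤ t →
    φ1 (h t ξ) ≤ v i t ξ ∧ v i t ξ ≤ φ2 (h0 t ξ)) ∧
  (∀ (i : Ic) (t : ℝ) (ξ : Stt n) (μ : Stt m), 0 ≤ t → χ ‖μ‖ ≤ v i t ξ →
    DiniAlong (F i) (v i) t ξ μ ≤ - vφ i t (v i t ξ)) ∧
  (∀ (ι i : Ic) (j : Id), (ι, i, j) ∈ J → ∀ (t : ℝ) (ξ : Stt n) (μ : Stt m),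
    0 ≤ t → χ ‖μ‖ ≤ v ι t ξ → v i t (ξ + G j t ξ μ) ≤ al (ι, i, j) t (v ι t ξ)) ∧
  (∀ (ι i : Ic) (j : Id), (ι, i, j) ∈ J → ∀ (t : ℝ) (ξ : Stt n) (μ : Stt m),
    0 ≤ t → v ι t ξ ≤ χ ‖μ‖ → v i t (ξ + G j t ξ μ) ≤ π ‖μ‖)

/-- A function whose increments are controlled by those of an absolutely continuous function is
absolutely continuous. -/
theorem AbsolutelyContinuousOnInterval.of_dist_le {X Y : Type*} [PseudoMetricSpace X]
    [PseudoMetricSpace Y] {f : ℝ → X} {g : ℝ → Y} {a b K : ℝ} (hK : 0 ≤ K)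
    (hg : AbsolutelyContinuousOnInterval g a b)
    (hfg : ∀ s ∈ uIcc a b, ∀ t ∈ uIcc a b, dist (f s) (f t) ≤ K * dist (g s) (g t)) :
    AbsolutelyContinuousOnInterval f a b := by
  rw [absolutelyContinuousOnInterval_iff] at hg ⊢
  intro ε hε
  obtain ⟨δ, hδ, H⟩ := hg (ε / (K + 1)) (by positivity)
  refine ⟨δ, hδ, fun E hE hlt => ?_⟩
  have h1 := H E hE hlt
  calc ∑ i ∈ Finset.range E.1, dist (f (E.2 i).1) (f (E.2 i).2)
      ≤ ∑ i ∈ Finset.range E.1, K * dist (g (E.2 i).1) (g (E.2 i).2) :=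
        Finset.sum_le_sum fun i hi => hfg _ (hE.1 i hi).1 _ (hE.1 i hi).2
    _ = K * ∑ i ∈ Finset.range E.1, dist (g (E.2 i).1) (g (E.2 i).2) := by
        rw [Finset.mul_sum]
    _ ≤ K * (ε / (K + 1)) := by gcongr
    _ < ε := by
        rw [mul_div_assoc', div_lt_iff₀ (by positivity)]
        nlinarith

theorem AbsolutelyContinuousOnInterval.exp {f : ℝ → ℝ} {a b : ℝ}
    (hf : AbsolutelyContinuousOnInterval f a b) :
    AbsolutelyContinuousOnInterval (fun s => Real.exp (f s)) a b := by
  have hcomp : IsCompact (f '' uIcc a b) := isCompact_uIcc.image_of_continuousOn hf.continuousOn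
  obtain ⟨K, hK⟩ := LocallyLipschitzOn.exists_lipschitzOnWith_of_compact hcomp
    ((Real.contDiff_exp (n := 1)).locallyLipschitz.locallyLipschitzOn)
  exact hf.of_dist_le K.2 fun s hs t ht =>
    hK.dist_le_mul _ (mem_image_of_mem f hs) _ (mem_image_of_mem f ht)

theorem AbsolutelyContinuousOnInterval.le_of_ae_deriv_nonpos {f : ℝ → ℝ} {a b : ℝ} (hab : a ≤ b)
    (hf : AbsolutelyContinuousOnInterval f a b)
    (hd : ∀ᵐ s, s ∈ Icc a b → deriv f s ≤ 0) : f b ≤ f a := by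
  have h1 := hf.integral_deriv_eq_sub
  have h2 : ∫ s in a..b, deriv f s ≤ 0 := by
    rw [intervalIntegral.integral_of_le hab]
    refine setIntegral_nonpos_of_ae_restrict ?_
    rw [EventuallyLE, ae_restrict_iff' measurableSet_Ioc]
    filter_upwards [hd] with s hs h using hs (Ioc_subset_Icc_self h)
  linarith

/-- Along an absolutely continuous curve with derivative `F`, a locally Lipschitz function is
absolutely continuous, and almost everywhere its derivative is the limit of the difference
quotients in the direction `F`. -/
theorem LocLipschitzOn.comp_curve {E : Type*} [NormedAddCommGroup E] [NormedSpace ℝ E]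
    [CompleteSpace E] {V : ℝ → E → ℝ} {x F : ℝ → E} {a b e : ℝ} (hab : a ≤ b) (hbe : b < e)
    (hV : LocLipschitzOn (Ico a e ×ˢ (univ : Set E)) fun q : ℝ × E => V q.1 q.2)
    (hF : IntegrableOn F (Icc a b)) (hx : ∀ t ∈ Icc a b, x t = x a + ∫ s in a..t, F s) :
    AbsolutelyContinuousOnInterval (fun s => V s (x s)) a b ∧
    ∀ᵐ s, s ∈ Icc a b → DifferentiableAt ℝ (fun s => V s (x s)) s ∧
      Tendsto (fun h => (V (s + h) (x s + h • F s) - V s (x s)) / h) (nhdsWithin 0 (Ioi 0))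
        (nhds (deriv (fun s => V s (x s)) s)) := by
  have hFi : ∀ s ∈ Icc a b, ∀ t ∈ Icc a b, IntervalIntegrable F volume s t := by
    intro s hs t ht
    rw [intervalIntegrable_iff]
    exact hF.mono_set (uIoc_subset_uIcc.trans (uIcc_subset_Icc hs ht))
  have ha : a ∈ Icc a b := left_mem_Icc.2 hab
  have hb : b ∈ Icc a b := right_mem_Icc.2 hab
  have hxc : ContinuousOn x (Icc a b) := by
    have h1 : ContinuousOn (fun t => x a + ∫ s in a..t, F s) (Icc a b) :=
      continuousOn_const.add (by
        have := intervalIntegral.continuousOn_primitive_interval (μ := volume) (f := F)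
          (a := a) (b := b) (by rwa [uIcc_of_le hab])
        rwa [uIcc_of_le hab] at this)
    exact h1.congr hx
  have hdx : ∀ s ∈ Icc a b, ∀ t ∈ Icc a b, x t - x s = ∫ r in s..t, F r := by
    intro s hs t ht
    rw [hx s hs, hx t ht, add_sub_add_left_eq_sub,
      intervalIntegral.integral_interval_sub_left (hFi a ha t ht) (hFi a ha s hs)]
  have hgc : IsCompact ((fun s => (s, x s)) '' Icc a b) :=
    isCompact_Icc.image_of_continuousOn (continuousOn_id.prodMk hxc)
  have hsub : (fun s => (s, x s)) '' Icc a b ⊆ Ico a e ×ˢ (univ : Set E) := by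
    rintro _ ⟨s, hs, rfl⟩
    exact ⟨⟨hs.1, hs.2.trans_lt hbe⟩, mem_univ _⟩
  have hVl : LocallyLipschitzOn (Ico a e ×ˢ (univ : Set E)) fun q : ℝ × E => V q.1 q.2 :=
    fun q hq => hV q hq
  obtain ⟨K, hK⟩ := (hVl.mono hsub).exists_lipschitzOnWith_of_compact hgc
  have hGi : IntervalIntegrable (fun s => 1 + ‖F s‖) volume a b :=
    intervalIntegrable_const.add (hFi a ha b hb).norm
  have hGac : AbsolutelyContinuousOnInterval (fun t => ∫ s in a..t, (1 + ‖F s‖)) a b :=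
    hGi.absolutelyContinuousOnInterval_intervalIntegral left_mem_uIcc
  have hle : ∀ s ∈ Icc a b, ∀ t ∈ Icc a b, s ≤ t → dist (V s (x s)) (V t (x t)) ≤
      K * dist (∫ r in a..s, (1 + ‖F r‖)) (∫ r in a..t, (1 + ‖F r‖)) := by
    intro s hs t ht hst
    have hGi' : ∀ s ∈ Icc a b, ∀ t ∈ Icc a b,
        IntervalIntegrable (fun s => 1 + ‖F s‖) volume s t :=
      fun s hs t ht => intervalIntegrable_const.add (hFi s hs t ht).norm
    have h1 := hK.dist_le_mul _ (mem_image_of_mem _ hs) _ (mem_image_of_mem _ ht)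
    refine h1.trans (mul_le_mul_of_nonneg_left ?_ K.2)
    rw [dist_comm (∫ r in a..s, (1 + ‖F r‖)), Real.dist_eq,
      intervalIntegral.integral_interval_sub_left (hGi' a ha t ht) (hGi' a ha s hs),
      intervalIntegral.integral_add intervalIntegrable_const (hFi s hs t ht).norm,
      intervalIntegral.integral_const, smul_eq_mul, mul_one]
    have h2 : 0 ≤ ∫ r in s..t, ‖F r‖ :=
      intervalIntegral.integral_nonneg hst fun _ _ => norm_nonneg _
    have h3 : ‖x t - x s‖ ≤ ∫ r in s..t, ‖F r‖ := by
      rw [hdx s hs t ht]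
      exact intervalIntegral.norm_integral_le_integral_norm hst
    rw [abs_of_nonneg (by linarith), Prod.dist_eq, max_le_iff]
    simp only [dist_comm s, dist_comm (x s), dist_eq_norm, Real.norm_eq_abs]
    rw [abs_of_nonneg (by linarith)]
    constructor <;> linarith
  have hac : AbsolutelyContinuousOnInterval (fun s => V s (x s)) a b := by
    refine hGac.of_dist_le K.2 fun s hs t ht => ?_
    rw [uIcc_of_le hab] at hs ht
    rcases le_total s t with h | h
    · exact hle s hs t ht h
    · rw [dist_comm, dist_comm (∫ r in a..s, (1 + ‖F r‖))]
      exact hle t ht s hs h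
  refine ⟨hac, ?_⟩
  have hnb : ∀ᵐ s : ℝ, s ≠ b := by simp [ae_iff, measure_singleton]
  have hna : ∀ᵐ s : ℝ, s ≠ a := by simp [ae_iff, measure_singleton]
  filter_upwards [hac.ae_differentiableAt, (hFi a ha b hb).ae_hasDerivAt_integral, hnb, hna]
    with s hs1 hs2 hsb hsa hs
  rw [uIcc_of_le hab] at hs1 hs2
  have hdiff := hs1 hs
  refine ⟨hdiff, ?_⟩
  have hsab : s ∈ Ioo a b := ⟨lt_of_le_of_ne hs.1 (Ne.symm hsa), lt_of_le_of_ne hs.2 hsb⟩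
  have hxd : HasDerivAt x (F s) s := by
    refine ((hs2 hs a ha).const_add (x a)).congr_of_eventuallyEq ?_
    filter_upwards [Icc_mem_nhds hsab.1 hsab.2] with t ht using hx t ht
  obtain ⟨K', U, hU, hLip⟩ := hV (s, x s) ⟨⟨hs.1, hs.2.trans_lt hbe⟩, mem_univ _⟩
  have hU' : U ∈ nhds (s, x s) := by
    rwa [nhdsWithin_eq_nhds.2] at hU
    exact prod_mem_nhds (Ico_mem_nhds hsab.1 (hsab.2.trans hbe)) univ_mem
  have hsx : Tendsto (fun h : ℝ => x (s + h)) (nhdsWithin 0 (Ioi 0)) (nhds (x s)) := by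
    have h1 : Tendsto (fun h : ℝ => s + h) (nhds 0) (nhds s) :=
      (continuous_const.add continuous_id).tendsto' (0 : ℝ) s (by simp)
    exact (hxd.continuousAt.tendsto.comp h1).mono_left nhdsWithin_le_nhds
  have hs0 : Tendsto (fun h : ℝ => s + h) (nhdsWithin 0 (Ioi 0)) (nhds s) :=
    ((continuous_const.add continuous_id).tendsto' (0 : ℝ) s (by simp)).mono_left
      nhdsWithin_le_nhds
  have hsl : Tendsto (fun h : ℝ => x s + h • F s) (nhdsWithin 0 (Ioi 0)) (nhds (x s)) :=
    ((continuous_const.add (continuous_id.smul continuous_const)).tendsto' (0 : ℝ) (x s)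
      (by simp)).mono_left nhdsWithin_le_nhds
  have hslope : Tendsto (fun h => h⁻¹ • (x (s + h) - x s)) (nhdsWithin 0 (Ioi 0)) (nhds (F s)) :=
    hxd.tendsto_slope_zero_right
  have hvs : Tendsto (fun h => h⁻¹ • (V (s + h) (x (s + h)) - V s (x s))) (nhdsWithin 0 (Ioi 0))
      (nhds (deriv (fun s => V s (x s)) s)) := hdiff.hasDerivAt.tendsto_slope_zero_right
  have herr : Tendsto (fun h => (V (s + h) (x s + h • F s) - V (s + h) (x (s + h))) / h)
      (nhdsWithin 0 (Ioi 0)) (nhds 0) := by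
    have hz : Tendsto (fun h => K' * ‖h⁻¹ • (x (s + h) - x s) - F s‖) (nhdsWithin 0 (Ioi 0))
        (nhds 0) := by
      have := ((hslope.sub_const (F s)).norm).const_mul (K' : ℝ)
      simpa using this
    refine squeeze_zero_norm' ?_ hz
    filter_upwards [(hs0.prodMk_nhds hsx).eventually hU', (hs0.prodMk_nhds hsl).eventually hU',
      self_mem_nhdsWithin] with h h1 h2 hpos
    have hpos : (0 : ℝ) < h := hpos
    have h3 := hLip.dist_le_mul _ h2 _ h1
    have h4 : h⁻¹ • (x (s + h) - x s) - F s = h⁻¹ • (x (s + h) - (x s + h • F s)) := by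
      rw [← sub_sub, smul_sub h⁻¹ (x (s + h) - x s), smul_smul, inv_mul_cancel₀ hpos.ne', one_smul]
    rw [h4, norm_smul, norm_div, Real.norm_of_nonneg hpos.le, norm_inv,
      Real.norm_of_nonneg hpos.le, div_le_iff₀ hpos, ← dist_eq_norm, ← dist_eq_norm]
    refine h3.trans (le_of_eq ?_)
    rw [Prod.dist_eq, dist_self, max_eq_right dist_nonneg, dist_comm (x (s + h))]
    field_simp
  have hsum := herr.add hvs
  rw [zero_add] at hsum
  refine hsum.congr fun h => ?_
  rw [smul_eq_mul]
  ring

/-- Multiplicative Grönwall estimate for an absolutely continuous function. -/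
theorem AbsolutelyContinuousOnInterval.le_exp_mul {v p : ℝ → ℝ} {a b : ℝ} (hab : a ≤ b)
    (hv : AbsolutelyContinuousOnInterval v a b) (hp : IntervalIntegrable p volume a b)
    (hd : ∀ᵐ s, s ∈ Icc a b → deriv v s ≤ -(p s * v s)) :
    v b ≤ Real.exp (-∫ s in a..b, p s) * v a := by
  have hP := hp.absolutelyContinuousOnInterval_intervalIntegral (c := a) left_mem_uIcc
  have hW := hP.exp.mul hv
  have key := hW.le_of_ae_deriv_nonpos hab (by
    filter_upwards [hd, hp.ae_hasDerivAt_integral, hv.ae_differentiableAt] with s h1 h2 h3 hs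
    rw [uIcc_of_le hab] at h2 h3
    have h4 := ((h2 hs a (left_mem_Icc.2 hab)).exp).mul (h3 hs).hasDerivAt
    have h5 := h4.deriv
    refine (le_of_eq h5).trans ?_
    have h6 := h1 hs
    have h7 := Real.exp_pos (∫ t in a..s, p t)
    nlinarith)
  simp only [Pi.mul_apply, intervalIntegral.integral_same, Real.exp_zero, one_mul] at key
  rw [Real.exp_neg, inv_mul_eq_div, le_div_iff₀ (Real.exp_pos _), mul_comm]
  exact key

theorem isLinSol_exp {p : ℝ → ℝ} (hp : LocIntegrable p) :
    IsLinSol p fun t => Real.exp (-∫ s in (0 : ℝ)..t, p s) := by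
  have hpi : ∀ a b : ℝ, IntervalIntegrable p volume a b := fun a b =>
    intervalIntegrable_iff.2 ((hp _ _).mono_set uIoc_subset_uIcc)
  intro t1 t2 h1 h12
  have hP : AbsolutelyContinuousOnInterval (fun t => Real.exp (-∫ s in (0 : ℝ)..t, p s)) 0 t2 :=
    (hpi 0 t2).absolutelyContinuousOnInterval_intervalIntegral left_mem_uIcc |>.neg.exp
  have hP' := hP.mono (c := t1) (d := t2)
    (uIcc_subset_uIcc (by rw [uIcc_of_le (h1.trans h12)]; exact ⟨h1, h12⟩) right_mem_uIcc)
  refine ⟨(hpi t1 t2).mul_continuousOn hP'.continuousOn, ?_⟩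
  have h3 := hP'.integral_deriv_eq_sub
  have h4 : ∫ s in t1..t2, -(p s * Real.exp (-∫ r in (0 : ℝ)..s, p r)) =
      ∫ s in t1..t2, deriv (fun t => Real.exp (-∫ s in (0 : ℝ)..t, p s)) s := by
    refine intervalIntegral.integral_congr_ae ?_
    filter_upwards [(hpi 0 t2).ae_hasDerivAt_integral] with s hs hmem
    rw [uIoc_of_le h12] at hmem
    have hs' := hs (by rw [uIcc_of_le (h1.trans h12)]; exact ⟨h1.trans hmem.1.le, hmem.2⟩) 0
      left_mem_uIcc
    rw [hs'.fun_neg.exp.deriv]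
    ring
  rw [h4]
  linarith

theorem ClassKInf.nonneg {φ : ℝ → ℝ} (h : ClassKInf φ) {r : ℝ} (hr : 0 ≤ r) : 0 ≤ φ r := by
  rw [← h.2.2.1]
  exact h.2.1.monotoneOn self_mem_Ici hr hr

theorem ClassKInf.comp {φ ψ : ℝ → ℝ} (h : ClassKInf φ) (k : ClassKInf ψ) :
    ClassKInf fun r => φ (ψ r) := by
  refine ⟨h.1.comp k.1 fun r hr => k.nonneg hr, fun r hr s hs hrs =>
    h.2.1 (k.nonneg hr) (k.nonneg hs) (k.2.1 hr hs hrs), by simp only [k.2.2.1, h.2.2.1],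
    fun M => ?_⟩
  obtain ⟨r, hr, hM⟩ := h.2.2.2 M
  obtain ⟨s, hs, hsr⟩ := k.2.2.2 r
  exact ⟨s, hs, hM.trans (h.2.1.monotoneOn hr (k.nonneg hs) hsr)⟩

theorem ClassKInf.const_mul {φ : ℝ → ℝ} (h : ClassKInf φ) {K : ℝ} (hK : 0 < K) :
    ClassKInf fun r => K * φ r := by
  refine ⟨continuousOn_const.mul h.1, fun r hr s hs hrs =>
    mul_lt_mul_of_pos_left (h.2.1 hr hs hrs) hK, by simp [h.2.2.1], fun M => ?_⟩
  obtain ⟨r, hr, hM⟩ := h.2.2.2 (M / K)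
  exact ⟨r, hr, by rwa [div_le_iff₀' hK] at hM⟩

theorem ClassKInf.add {φ ψ : ℝ → ℝ} (h : ClassKInf φ) (k : ClassKInf ψ) :
    ClassKInf fun r => φ r + ψ r := by
  refine ⟨h.1.add k.1, fun r hr s hs hrs => add_lt_add (h.2.1 hr hs hrs) (k.2.1 hr hs hrs),
    by simp [h.2.2.1, k.2.2.1], fun M => ?_⟩
  obtain ⟨r, hr, hM⟩ := h.2.2.2 M
  exact ⟨r, hr, by linarith [k.nonneg hr]⟩

theorem ClassKInf.exists_leftInverse {φ : ℝ → ℝ} (h : ClassKInf φ) :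
    ∃ ψ : ℝ → ℝ, ClassKInf ψ ∧ ∀ r, 0 ≤ r → ψ (φ r) = r := by
  set Φ : ℝ → ℝ := fun x => φ (max x 0) + min x 0 with hΦ
  have hΦφ : ∀ r, 0 ≤ r → Φ r = φ r := fun r hr => by simp [hΦ, hr]
  have hc : Continuous Φ :=
    (h.1.comp_continuous (continuous_id.max continuous_const) fun x => le_max_right x 0).add
      (continuous_id.min continuous_const)
  have hm : StrictMono Φ := by
    intro x y hxy
    rcases le_or_gt y 0 with hy | hy
    · simp [hΦ, hxy.le.trans hy, hy, hxy]
    · have h1 : max x 0 < max y 0 := by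
        rw [max_eq_left hy.le]
        exact max_lt hxy hy
      have h2 := h.2.1 (le_max_right x 0) (le_max_right y 0) h1
      have h3 : min x 0 ≤ min y 0 := min_le_min_right 0 hxy.le
      simp only [hΦ]
      linarith
  have hs : Function.Surjective Φ := by
    refine hc.surjective ?_ ?_
    · refine hm.monotone.tendsto_atTop_atTop fun M => ?_
      obtain ⟨r, hr, hM⟩ := h.2.2.2 M
      exact ⟨r, by rwa [hΦφ r hr]⟩
    · refine hm.monotone.tendsto_atBot_atBot fun M => ⟨min M 0, ?_⟩
      simp [hΦ, h.2.2.1]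
  let e := hm.orderIsoOfSurjective Φ hs
  have he : ∀ r, 0 ≤ r → e.symm (φ r) = r := fun r hr => by
    rw [← hΦφ r hr]
    exact e.symm_apply_apply r
  have he0 : e.symm 0 = 0 := by
    have := he 0 le_rfl
    rwa [h.2.2.1] at this
  refine ⟨e.symm, ⟨e.symm.continuous.continuousOn, e.symm.strictMono.strictMonoOn _, he0,
    fun M => ⟨φ (max M 0), h.nonneg (le_max_right M 0), ?_⟩⟩, he⟩
  rw [he _ (le_max_right M 0)]
  exact le_max_left M 0

theorem IsImpulseSeq.finite_inter_Ioc {γ : Set ℝ} (hγ : IsImpulseSeq γ) (s t : ℝ) :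
    (γ ∩ Ioc s t).Finite :=
  (hγ.2 t).subset (inter_subset_inter_right _ Ioc_subset_Iic_self)

theorem IsImpulseSeq.eventually_notMem {γ : Set ℝ} (hγ : IsImpulseSeq γ) (b : ℝ) :
    ∀ᶠ s in nhdsWithin b {b}ᶜ, s ∉ γ := by
  have h1 : ((γ ∩ Iic (b + 1)) \ {b})ᶜ ∈ nhds b :=
    ((hγ.2 (b + 1)).subset sdiff_subset).isClosed.isOpen_compl.mem_nhds (by simp)
  filter_upwards [nhdsWithin_le_nhds h1, nhdsWithin_le_nhds (Iio_mem_nhds (lt_add_one b)),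
    self_mem_nhdsWithin] with s hs hs1 hsb hsγ
  exact hs ⟨⟨hsγ, (mem_Iio.1 hs1).le⟩, hsb⟩

theorem IsImpulseSeq.exists_gap_right {γ : Set ℝ} (hγ : IsImpulseSeq γ) (b : ℝ) :
    ∃ e, b < e ∧ Ioo b e ∩ γ = ∅ := by
  have h := (hγ.eventually_notMem b).filter_mono
    (nhdsWithin_mono b fun s (hs : b < s) => hs.ne')
  obtain ⟨e, he, hsub⟩ := mem_nhdsGT_iff_exists_Ioo_subset.1 h
  exact ⟨e, he, by ext s; simpa using fun h1 h2 => hsub ⟨h1, h2⟩⟩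

theorem nJumps_add {γ : Set ℝ} (hγ : IsImpulseSeq γ) {r s t : ℝ} (hrs : r ≤ s) (hst : s ≤ t) :
    nJumps γ r t = nJumps γ r s + nJumps γ s t := by
  unfold nJumps
  rw [← Ioc_union_Ioc_eq_Ioc hrs hst, inter_union_distrib_left]
  refine ncard_union_eq ?_ (hγ.finite_inter_Ioc _ _) (hγ.finite_inter_Ioc _ _)
  exact (Ioc_disjoint_Ioc_of_le le_rfl).mono inter_subset_right inter_subset_right

theorem nJumps_eq_zero {γ : Set ℝ} {s t : ℝ} (h : Ioc s t ∩ γ = ∅) : nJumps γ s t = 0 := by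
  rw [nJumps, inter_comm, h, ncard_empty]

/-- Growth factor over `(r,s]` of the linear comparison system `ẇ = -p w`, `w⁺ = d w⁻`. -/
def growthFactor (γ : Set ℝ) (p : ℝ → ℝ) (d r s : ℝ) : ℝ :=
  Real.exp (-∫ q in r..s, p q) * d ^ nJumps γ r s

theorem growthFactor_nonneg {γ : Set ℝ} {p : ℝ → ℝ} {d : ℝ} (hd : 0 ≤ d) (r s : ℝ) :
    0 ≤ growthFactor γ p d r s := by
  unfold growthFactor
  positivity

theorem growthFactor_self (γ : Set ℝ) (p : ℝ → ℝ) (d r : ℝ) : growthFactor γ p d r r = 1 := by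
  simp [growthFactor, nJumps]

theorem growthFactor_mul {γ : Set ℝ} (hγ : IsImpulseSeq γ) {p : ℝ → ℝ} (hp : LocIntegrable p)
    (d : ℝ) {r s t : ℝ} (hrs : r ≤ s) (hst : s ≤ t) :
    growthFactor γ p d s t * growthFactor γ p d r s = growthFactor γ p d r t := by
  have hpi : ∀ a b : ℝ, IntervalIntegrable p volume a b := fun a b =>
    intervalIntegrable_iff.2 ((hp _ _).mono_set uIoc_subset_uIcc)
  unfold growthFactor
  rw [nJumps_add hγ hrs hst, ← intervalIntegral.integral_add_adjacent_intervals (hpi r s) (hpi s t),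
    neg_add, Real.exp_add, pow_add]
  ring

/-- `v` at time `s` is dominated by the comparison system, started either at time `t0` from
`v t0`, or at some later time from the level `M`. -/
def ComparisonBound (γ : Set ℝ) (p v : ℝ → ℝ) (d M t0 s : ℝ) : Prop :=
  v s ≤ growthFactor γ p d t0 s * v t0 ∨ ∃ r ∈ Icc t0 s, v s ≤ growthFactor γ p d r s * M

theorem ComparisonBound.of_le {γ : Set ℝ} {p v : ℝ → ℝ} {d M t0 s : ℝ} (h0 : t0 ≤ s)
    (h : v s ≤ M) : ComparisonBound γ p v d M t0 s :=
  Or.inr ⟨s, ⟨h0, le_rfl⟩, by rwa [growthFactor_self, one_mul]⟩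

theorem ComparisonBound.trans {γ : Set ℝ} (hγ : IsImpulseSeq γ) {p v : ℝ → ℝ}
    (hp : LocIntegrable p) {d M t0 a b : ℝ} (hd : 0 ≤ d) (h0 : t0 ≤ a) (hab : a ≤ b)
    (ha : ComparisonBound γ p v d M t0 a) (h : v b ≤ growthFactor γ p d a b * v a) :
    ComparisonBound γ p v d M t0 b := by
  have hg := growthFactor_nonneg (γ := γ) (p := p) hd a b
  rcases ha with ha | ⟨r, hr, ha⟩
  · left
    rw [← growthFactor_mul hγ hp d h0 hab, mul_assoc]
    exact h.trans (mul_le_mul_of_nonneg_left ha hg)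
  · right
    refine ⟨r, ⟨hr.1, hr.2.trans hab⟩, ?_⟩
    rw [← growthFactor_mul hγ hp d hr.2 hab, mul_assoc]
    exact h.trans (mul_le_mul_of_nonneg_left ha hg)

/-- Comparison principle: a function that decays like `ẇ = -p w` between impulses while above the
level `M`, and at impulses either falls below `M` or shrinks by the factor `d`, is dominated by the
linear comparison system. -/
theorem comparisonBound_of_flow_jump {γ : Set ℝ} (hγ : IsImpulseSeq γ) {p v : ℝ → ℝ}
    (hp : LocIntegrable p) {d M t0 t : ℝ} (hd : 0 ≤ d) (hd1 : d < 1) (hM : 0 ≤ M) (ht : t0 ≤ t)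
    (hcont : ∀ a b, t0 ≤ a → a ≤ b → b ≤ t → Ioc a b ∩ γ = ∅ → ContinuousOn v (Icc a b))
    (hflow : ∀ a b, t0 ≤ a → a ≤ b → b ≤ t → Ioc a b ∩ γ = ∅ → (∀ s ∈ Ioc a b, M < v s) →
      v b ≤ Real.exp (-∫ s in a..b, p s) * v a)
    (hjump : ∀ τ ∈ γ, t0 < τ → τ ≤ t → v τ ≤ M ∨
      ∃ L, Tendsto v (nhdsWithin τ (Iio τ)) (nhds L) ∧ v τ ≤ d * L) :
    ComparisonBound γ p v d M t0 t := by
  have hflow' : ∀ a b, t0 ≤ a → a ≤ b → b ≤ t → Ioc a b ∩ γ = ∅ → (∀ s ∈ Ioc a b, M < v s) →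
      v b ≤ growthFactor γ p d a b * v a := by
    intro a b h1 h2 h3 h4 h5
    rw [growthFactor, nJumps_eq_zero h4, pow_zero, mul_one]
    exact hflow a b h1 h2 h3 h4 h5
  have step : ∀ a b, t0 ≤ a → a ≤ b → b ≤ t → Ioc a b ∩ γ = ∅ →
      ComparisonBound γ p v d M t0 a → ComparisonBound γ p v d M t0 b := by
    intro a b h1 h2 h3 h4 ha
    by_cases hall : ∀ s ∈ Ioc a b, M < v s
    · exact ha.trans hγ hp hd h1 h2 (hflow' a b h1 h2 h3 h4 hall)
    · push Not at hall
      obtain ⟨s0, hs0, hs0M⟩ := hall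
      have hS : IsCompact (Icc a b ∩ v ⁻¹' Iic M) :=
        isCompact_Icc.of_isClosed_subset
          ((hcont a b h1 h2 h3 h4).preimage_isClosed_of_isClosed isClosed_Icc isClosed_Iic)
          inter_subset_left
      obtain ⟨r, ⟨hr, hrM⟩, hmax⟩ := hS.exists_isGreatest ⟨s0, Ioc_subset_Icc_self hs0, hs0M⟩
      refine (ComparisonBound.of_le (h1.trans hr.1) hrM).trans hγ hp hd (h1.trans hr.1) hr.2
        (hflow' r b (h1.trans hr.1) hr.2 h3 ?_ ?_)
      · exact subset_empty_iff.1
          ((inter_subset_inter_left _ (Ioc_subset_Ioc_left hr.1)).trans h4.subset)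
      · intro s hs
        by_contra hle
        exact absurd (hmax ⟨⟨hr.1.trans hs.1.le, hs.2⟩, not_lt.1 hle⟩) (not_le.2 hs.1)
  have main : ∀ k : ℕ, ∀ b, t0 ≤ b → b ≤ t → nJumps γ t0 b = k →
      ComparisonBound γ p v d M t0 b := by
    intro k
    induction k using Nat.strong_induction_on with
    | _ k ih =>
      intro b hb hbt hk
      have hstart : ComparisonBound γ p v d M t0 t0 := by
        left
        rw [growthFactor_self, one_mul]
      by_cases hne : (γ ∩ Ioc t0 b).Nonempty
      · obtain ⟨τ, ⟨hτγ, hτ⟩, hmax⟩ :=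
          (hγ.finite_inter_Ioc t0 b).isCompact.exists_isGreatest hne
        refine step τ b hτ.1.le hτ.2 hbt ?_ ?_
        · refine eq_empty_of_forall_notMem ?_
          rintro s ⟨hs, hsγ⟩
          exact absurd (hmax ⟨hsγ, hτ.1.trans hs.1, hs.2⟩) (not_le.2 hs.1)
        · rcases hjump τ hτγ hτ.1 (hτ.2.trans hbt) with hle | ⟨L, hL, hvL⟩
          · exact ComparisonBound.of_le hτ.1.le hle
          · rcases le_or_gt L M with hLM | hLM
            · refine ComparisonBound.of_le hτ.1.le (hvL.trans ?_)
              nlinarith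
            · have hev : ∀ᶠ s in nhdsWithin τ (Iio τ), M < v s ∧ s ∉ γ ∧ t0 < s := by
                filter_upwards [hL.eventually (lt_mem_nhds hLM),
                  (hγ.eventually_notMem τ).filter_mono
                    (nhdsWithin_mono τ fun s (hs : s < τ) => hs.ne),
                  nhdsWithin_le_nhds (Ioi_mem_nhds hτ.1)] with s h1 h2 h3 using ⟨h1, h2, h3⟩
              obtain ⟨l, hl, hsub⟩ := mem_nhdsLT_iff_exists_Ioo_subset.1 hev
              obtain ⟨a, hla, haτ⟩ := exists_between (show l < τ from hl)
              have hat : t0 < a := (hsub ⟨hla, haτ⟩).2.2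
              have hgap : ∀ s, s < τ → Ioc a s ∩ γ = ∅ := by
                intro s hs
                refine eq_empty_of_forall_notMem ?_
                rintro q ⟨hq, hqγ⟩
                exact (hsub ⟨hla.trans hq.1, hq.2.trans_lt hs⟩).2.1 hqγ
              have hone : nJumps γ a τ = 1 := by
                rw [nJumps, ncard_eq_one]
                refine ⟨τ, Subset.antisymm ?_ ?_⟩
                · rintro q ⟨hqγ, hq⟩
                  by_contra hne'
                  exact (hsub ⟨hla.trans hq.1, lt_of_le_of_ne hq.2 hne'⟩).2.1 hqγ
                · rintro _ rfl
                  exact ⟨hτγ, haτ, le_rfl⟩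
              have hlt : nJumps γ t0 a < k := by
                have e1 := nJumps_add hγ hat.le (haτ.le.trans hτ.2)
                have e2 := nJumps_add hγ haτ.le hτ.2
                omega
              have hPa := ih _ hlt a hat.le (haτ.le.trans (hτ.2.trans hbt)) rfl
              refine hPa.trans hγ hp hd hat.le haτ.le ?_
              have hlim : Tendsto (fun s => Real.exp (-∫ q in a..s, p q) * v a)
                  (nhdsWithin τ (Iio τ)) (nhds (Real.exp (-∫ q in a..τ, p q) * v a)) := by
                have hc : ContinuousOn (fun s => ∫ q in a..s, p q) (uIcc a τ) :=
                  intervalIntegral.continuousOn_primitive_interval (hp _ _)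
                have hc' : ContinuousWithinAt (fun s => ∫ q in a..s, p q) (Iio τ) τ := by
                  refine (hc τ right_mem_uIcc).mono_of_mem_nhdsWithin ?_
                  rw [uIcc_of_le haτ.le]
                  exact Icc_mem_nhdsLT haτ
                exact (hc'.neg.rexp).mul_const (v a)
              have hLle : L ≤ Real.exp (-∫ q in a..τ, p q) * v a := by
                refine le_of_tendsto_of_tendsto hL hlim ?_
                filter_upwards [Ioo_mem_nhdsLT haτ] with s hs
                exact hflow a s hat.le hs.1.le (hs.2.le.trans (hτ.2.trans hbt)) (hgap s hs.2)
                  fun q hq => (hsub ⟨hla.trans hq.1, hq.2.trans_lt hs.2⟩).1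
              rw [growthFactor, hone, pow_one]
              calc v τ ≤ d * L := hvL
                _ ≤ d * (Real.exp (-∫ q in a..τ, p q) * v a) :=
                  mul_le_mul_of_nonneg_left hLle hd
                _ = _ := by ring
      · refine step t0 b le_rfl hb hbt ?_ hstart
        rw [inter_comm]
        exact not_nonempty_iff_eq_empty.1 hne
  exact main _ t ht le_rfl rfl

/-- Under a reverse average dwell-time bound, contraction at the impulses dominates exponential
growth of rate `-c` along the flow. -/
theorem exists_exp_bound_of_reverse_dwell_time {κ c d τD : ℝ} (N0 : ℕ) (hκ : 0 < κ) (hc : c ≤ 0)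
    (hd : 0 ≤ d) (hd1 : d < 1) (hτD : 0 < τD)
    (hlog : c ≠ 0 → 0 < d → τD < |Real.log d / c|) :
    ∃ K > 0, ∃ ω > 0, ∀ (δ : ℝ) (k : ℕ), δ / τD - N0 ≤ k →
      κ * Real.exp (-(c * δ)) * d ^ k ≤ K * Real.exp (-(ω * (δ + k))) := by
  have hq : Real.exp (-(c * τD)) * d < 1 := by
    rcases hd.eq_or_lt with rfl | hd0
    · simp
    rcases eq_or_ne c 0 with rfl | hc0
    · simpa using hd1
    have hcneg : c < 0 := lt_of_le_of_ne hc hc0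
    have h1 := hlog hc0 hd0
    rw [abs_of_pos (div_pos_of_neg_of_neg (Real.log_neg hd0 hd1) hcneg), lt_div_iff_of_neg hcneg]
      at h1
    rw [← Real.exp_log hd0, ← Real.exp_add, Real.exp_lt_one_iff]
    linarith
  set q := max (Real.exp (-(c * τD)) * d) (1 / 2) with hqdef
  have hq0 : 0 < q := lt_of_lt_of_le (by norm_num) (le_max_right _ _)
  have hq1 : q < 1 := max_lt hq (by norm_num)
  set ω := -Real.log q / (1 + τD) with hω
  have hωpos : 0 < ω := div_pos (by linarith [Real.log_neg hq0 hq1]) (by linarith)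
  have hlogq : Real.log q = -(ω * (1 + τD)) := by
    rw [hω]
    field_simp
  refine ⟨κ * Real.exp (-(c * τD * N0)) * Real.exp (ω * τD * N0), by positivity, ω, hωpos,
    fun δ k hk => ?_⟩
  have hδ : δ ≤ τD * (k + N0) := by
    rw [sub_le_iff_le_add, div_le_iff₀ hτD] at hk
    linarith
  have h1 : Real.exp (-(c * δ)) ≤ Real.exp (-(c * τD * N0)) * Real.exp (-(c * τD)) ^ k := by
    rw [← Real.exp_nat_mul, ← Real.exp_add, Real.exp_le_exp]
    nlinarith
  have h2 : (Real.exp (-(c * τD)) * d) ^ k ≤ q ^ k :=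
    pow_le_pow_left₀ (by positivity) (le_max_left _ _) k
  have h3 : q ^ k ≤ Real.exp (ω * τD * N0) * Real.exp (-(ω * (δ + k))) := by
    rw [← Real.exp_log hq0, ← Real.exp_nat_mul, ← Real.exp_add, Real.exp_le_exp, hlogq]
    nlinarith
  calc κ * Real.exp (-(c * δ)) * d ^ k
      ≤ κ * (Real.exp (-(c * τD * N0)) * Real.exp (-(c * τD)) ^ k) * d ^ k := by gcongr
    _ = κ * Real.exp (-(c * τD * N0)) * (Real.exp (-(c * τD)) * d) ^ k := by
        rw [mul_pow]
        ring
    _ ≤ κ * Real.exp (-(c * τD * N0)) *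
          (Real.exp (ω * τD * N0) * Real.exp (-(ω * (δ + k)))) := by
        gcongr
        exact h2.trans h3
    _ = _ := by ring

theorem inputNorm_nonneg {m : ℕ} (γ : Set ℝ) (u : ℝ → Stt m) (I : Set ℝ) :
    0 ≤ inputNorm γ u I := by
  refine le_max_of_le_right (Real.sSup_nonneg ?_)
  rintro _ ⟨s, -, rfl⟩
  exact norm_nonneg _

theorem norm_le_inputNorm_of_mem {m : ℕ} {γ : Set ℝ} (hγ : IsImpulseSeq γ) (u : ℝ → Stt m)
    {t0 t τ : ℝ} (hτ : τ ∈ γ) (h : τ ∈ Ioc t0 t) : ‖u τ‖ ≤ inputNorm γ u (Ioc t0 t) :=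
  le_max_of_le_right
    (le_csSup ((hγ.finite_inter_Ioc t0 t).image _).bddAbove (mem_image_of_mem _ ⟨hτ, h⟩))

theorem ae_norm_le_inputNorm {m : ℕ} (γ : Set ℝ) {u : ℝ → Stt m} (hu : IsInput u)
    {t0 t : ℝ} (h0 : 0 ≤ t0) :
    ∀ᵐ s, s ∈ Ioc t0 t → ‖u s‖ ≤ inputNorm γ u (Ioc t0 t) := by
  obtain ⟨C, hC⟩ := hu.2 t
  have hb : IsBoundedUnder (· ≤ ·) (ae (volume.restrict (Ioc t0 t))) fun s => ‖u s‖ := by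
    refine ⟨C, ?_⟩
    rw [eventually_map, ae_restrict_iff' measurableSet_Ioc]
    filter_upwards [hC] with s hs hmem using hs ⟨h0.trans hmem.1.le, hmem.2⟩
  have h1 := ae_le_essSup hb
  rw [ae_restrict_iff' measurableSet_Ioc] at h1
  filter_upwards [h1] with s hs hmem using (hs hmem).trans (le_max_left _ _)

/-- Between impulses, `V` along a solution is absolutely continuous and its derivative is almost
everywhere the Dini derivative of `V` along the flow map. -/
theorem IsSolution.ac_and_deriv_eq_diniAlong {n m : ℕ} {γ : Set ℝ}
    {f g : ℝ → Stt n → Stt m → Stt n} {t0 : ℝ} {x0 : Stt n} {u : ℝ → Stt m} {T : EReal}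
    {x : ℝ → Stt n} (hx : IsSolution γ f g t0 x0 u T x) (hγ : IsImpulseSeq γ)
    {V Vm : ℝ → Stt n → ℝ} (hV : InClassV γ V Vm) (h0 : 0 ≤ t0) {a b : ℝ} (ha : t0 ≤ a)
    (hab : a ≤ b) (hb : (b : EReal) < T) (hgap : Ioc a b ∩ γ = ∅) :
    AbsolutelyContinuousOnInterval (fun s => V s (x s)) a b ∧
    ∀ᵐ s, s ∈ Icc a b → deriv (fun s => V s (x s)) s = DiniAlong f V s (x s) (u s) := by
  obtain ⟨e, hbe, he⟩ := hγ.exists_gap_right b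
  have hgap' : Ioo a e ∩ γ = ∅ := by
    refine eq_empty_of_forall_notMem ?_
    rintro s ⟨hs, hsγ⟩
    rcases le_or_gt s b with h | h
    · exact (hgap.subset ⟨⟨hs.1, h⟩, hsγ⟩ : s ∈ (∅ : Set ℝ))
    · exact (he.subset ⟨⟨h, hs.2⟩, hsγ⟩ : s ∈ (∅ : Set ℝ))
  have hcurve := (hV.1 a e (h0.trans ha) hgap').comp_curve (x := x) hab hbe
    (hx.flow a b ha hab hb hgap).1 fun t ht =>
      (hx.flow a t ha ht.1 ((EReal.coe_le_coe_iff.2 ht.2).trans_lt hb)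
        (subset_empty_iff.1 ((inter_subset_inter_left _
          (Ioc_subset_Ioc_right ht.2)).trans hgap.subset))).2
  refine ⟨hcurve.1, ?_⟩
  filter_upwards [hcurve.2] with s hs hmem
  exact (hs hmem).2.limsup_eq.symm

/-- The left limit of `V` along a solution at an impulse time. -/
theorem InClassV.tendsto_along {n : ℕ} {γ : Set ℝ} {V Vm : ℝ → Stt n → ℝ}
    (hV : InClassV γ V Vm) {x : ℝ → Stt n} {τ : ℝ} {L : Stt n} (hτ : τ ∈ γ)
    (hL : Tendsto x (nhdsWithin τ (Iio τ)) (nhds L)) :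
    Tendsto (fun s => V s (x s)) (nhdsWithin τ (Iio τ)) (nhds (Vm τ L)) := by
  refine (hV.2 τ hτ L).comp (f := fun s => (s, x s)) (tendsto_nhdsWithin_iff.2 ⟨?_, ?_⟩)
  · exact (tendsto_id.mono_left nhdsWithin_le_nhds).prodMk_nhds hL
  · filter_upwards [self_mem_nhdsWithin] with s hs using ⟨hs, mem_univ _⟩

theorem classKL_comp_exp {φ ψ : ℝ → ℝ} (hφ : ClassKInf φ) (hψ : ClassKInf ψ) {K ω : ℝ}
    (hK : 0 < K) (hω : 0 < ω) :
    ClassKL fun r t => ψ (K * Real.exp (-(ω * t)) * φ r) := by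
  refine ⟨fun t _ => hψ.comp (hφ.const_mul (by positivity)), fun r hr => ⟨?_, ?_⟩⟩
  · intro s _ t _ hst
    have h1 := hφ.nonneg hr
    refine hψ.2.1.monotoneOn (mem_Ici.2 (by positivity)) (mem_Ici.2 (by positivity)) ?_
    gcongr
  · have h1 : Tendsto (fun t => K * Real.exp (-(ω * t)) * φ r) atTop (nhds 0) := by
      have h2 : Tendsto (fun t => Real.exp (-(ω * t))) atTop (nhds 0) :=
        Real.tendsto_exp_neg_atTop_nhds_zero.comp (tendsto_id.const_mul_atTop hω)
      simpa using (h2.const_mul K).mul_const (φ r)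
    have h3 := hψ.1 0 self_mem_Ici
    have h4 := h3.tendsto.comp (tendsto_nhdsWithin_iff.2 ⟨h1, Eventually.of_forall fun t =>
      mem_Ici.2 (mul_nonneg (by positivity) (hφ.nonneg hr))⟩)
    rwa [hψ.2.2.1] at h4

/-- Corollary 1(b): strong `(h⁰,h)`-ISS under a reverse average dwell-time
condition. -/
theorem stmt7 {n m : ℕ} {Λ : Type*} (γ : Λ → Set ℝ)
    (f g : Λ → ℝ → Stt n → Stt m → Stt n)
    (hγ : ∀ l : Λ, IsImpulseSeq (γ l))
    (h0 h : ℝ → Stt n → ℝ)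
    (hh0 : ∀ (t : ℝ) (ξ : Stt n), 0 ≤ t → 0 ≤ h0 t ξ)
    (hh : ∀ (t : ℝ) (ξ : Stt n), 0 ≤ t → 0 ≤ h t ξ)
    (V Vm : Λ → ℝ → Stt n → ℝ) (φ1 φ2 χ π : ℝ → ℝ)
    (p : Λ → ℝ → ℝ) (d : ℝ) (hd : 0 ≤ d)
    (hpmeas : ∀ l : Λ, Measurable (p l)) (hploc : ∀ l : Λ, LocIntegrable (p l))
    (hA1 : Assumption1 γ f g h0 h V Vm φ1 φ2 χ π
      (fun l t r => p l t * r) (fun _ _ r => d * r))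
    (κ c : ℝ) (hκ : 0 < κ)
    (hlin : ∀ (l : Λ) (w : ℝ → ℝ), IsLinSol (p l) w →
      ∀ t0 t : ℝ, 0 ≤ t0 → t0 ≤ t → |w t| ≤ κ * Real.exp (-(c * (t - t0))) * |w t0|)
    (hc : c ≤ 0) (hd1 : d < 1) (N0 : ℕ) (τD : ℝ) (hτD : 0 < τD)
    (hτDlog : c ≠ 0 → 0 < d → τD < |Real.log d / c|)
    (hRADT : ∀ (l : Λ) (s t : ℝ), 0 ≤ s → s < t →
      (t - s) / τD - (N0 : ℝ) ≤ (nJumps (γ l) s t : ℝ)) :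
    StronglyISS γ f g h0 h := by
  obtain ⟨hφ1, hφ2, hχ, hπ, hV, -, -, hsand, hdini, hjump, hjump'⟩ := hA1
  obtain ⟨K, hK, ω, hω, hKω⟩ :=
    exists_exp_bound_of_reverse_dwell_time N0 hκ hc hd hd1 hτD hτDlog
  obtain ⟨ψ, hψ, hψφ⟩ := hφ1.exists_leftInverse
  have hgrow : ∀ (l : Λ) (r s : ℝ), 0 ≤ r → r ≤ s → growthFactor (γ l) (p l) d r s ≤
      K * Real.exp (-(ω * (s - r + (nJumps (γ l) r s : ℝ)))) := by
    intro l r s hr hrs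
    have hpi : ∀ a b : ℝ, IntervalIntegrable (p l) volume a b := fun a b =>
      intervalIntegrable_iff.2 ((hploc l _ _).mono_set uIoc_subset_uIcc)
    have h1 := hlin l _ (isLinSol_exp (hploc l)) r s hr hrs
    have h2 : Real.exp (-∫ q in r..s, p l q) ≤ κ * Real.exp (-(c * (s - r))) := by
      rw [Real.abs_exp, Real.abs_exp,
        ← intervalIntegral.integral_add_adjacent_intervals (hpi 0 r) (hpi r s), neg_add,
        Real.exp_add, mul_comm] at h1
      exact le_of_mul_le_mul_right h1 (Real.exp_pos _)
    have h3 : (s - r) / τD - N0 ≤ (nJumps (γ l) r s : ℝ) := by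
      rcases hrs.eq_or_lt with rfl | h
      · have : (0 : ℝ) ≤ N0 := Nat.cast_nonneg _
        rw [sub_self, zero_div]
        exact (by linarith : (0 : ℝ) - N0 ≤ 0).trans (Nat.cast_nonneg _)
      · exact hRADT l r s hr h
    exact (mul_le_mul_of_nonneg_right h2 (by positivity)).trans (hKω _ _ h3)
  refine ⟨fun r t => ψ (K * Real.exp (-(ω * t)) * φ2 r), fun r => ψ (K * (χ r + π r)),
    classKL_comp_exp hφ2 hψ hK hω, hψ.comp ((hχ.add hπ).const_mul hK), ?_⟩
  intro l t0 x0 u T x ht0 hu hx t ht htT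
  set R := inputNorm (γ l) u (Ioc t0 t) with hR
  have hR0 : 0 ≤ R := inputNorm_nonneg _ _ _
  have hχR := hχ.nonneg hR0
  have hπR := hπ.nonneg hR0
  have hbT : ∀ b, b ≤ t → (b : EReal) < T := fun b hb =>
    (EReal.coe_le_coe_iff.2 hb).trans_lt htT
  have hbound : ComparisonBound (γ l) (p l) (fun s => V l s (x s)) d (χ R + π R) t0 t := by
    refine comparisonBound_of_flow_jump (hγ l) (hploc l) hd hd1 (add_nonneg hχR hπR) ht ?_ ?_ ?_
    · intro a b ha hab hb hgap
      have := (hx.1.ac_and_deriv_eq_diniAlong (hγ l) (hV l) ht0 ha hab (hbT b hb)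
        hgap).1.continuousOn
      rwa [uIcc_of_le hab] at this
    · intro a b ha hab hb hgap hlarge
      obtain ⟨hac, hder⟩ :=
        hx.1.ac_and_deriv_eq_diniAlong (hγ l) (hV l) ht0 ha hab (hbT b hb) hgap
      refine hac.le_exp_mul hab
        (intervalIntegrable_iff.2 ((hploc l _ _).mono_set uIoc_subset_uIcc)) ?_
      have hna : ∀ᵐ s : ℝ, s ≠ a := by simp [ae_iff, measure_singleton]
      filter_upwards [hder, hna, ae_norm_le_inputNorm (γ l) hu (t := t) ht0] with s h1 h2 h3 hs
      have hs' : s ∈ Ioc a b := ⟨lt_of_le_of_ne hs.1 (Ne.symm h2), hs.2⟩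
      rw [h1 hs]
      refine hdini l s (x s) (u s) (ht0.trans (ha.trans hs.1))
        (fun hsγ => (hgap.subset ⟨hs', hsγ⟩ : s ∈ (∅ : Set ℝ))) ?_
      have h4 := hχ.2.1.monotoneOn (norm_nonneg (u s)) hR0
        (h3 ⟨ha.trans_lt hs'.1, hs'.2.trans hb⟩)
      have h5 := hlarge s hs'
      linarith
    · intro τ hτ hτ0 hτt
      obtain ⟨L, hL, hxL⟩ := hx.1.jump τ hτ hτ0 (hbT τ hτt)
      have huR := norm_le_inputNorm_of_mem (hγ l) u hτ ⟨hτ0, hτt⟩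
      rcases le_total (χ ‖u τ‖) (Vm l τ L) with h | h
      · refine Or.inr ⟨Vm l τ L, (hV l).tendsto_along hτ hL, ?_⟩
        simp only [hxL]
        exact hjump l τ L (u τ) hτ h
      · left
        simp only [hxL]
        have h1 := hjump' l τ L (u τ) hτ h
        have h2 := hπ.2.1.monotoneOn (norm_nonneg (u τ)) hR0 huR
        linarith
  have hle : V l t (x t) ≤
      max (K * Real.exp (-(ω * (t - t0 + (nJumps (γ l) t0 t : ℝ)))) * φ2 (h0 t0 x0))
        (K * (χ R + π R)) := by
    rcases hbound with hb | ⟨r, hr, hb⟩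
    · refine le_max_of_le_left (hb.trans ?_)
      have h1 := (hsand l t0 x0 ht0).2
      simp only [hx.1.init]
      exact (mul_le_mul_of_nonneg_left h1 (growthFactor_nonneg hd _ _)).trans
        (mul_le_mul_of_nonneg_right (hgrow l t0 t ht0 ht) (hφ2.nonneg (hh0 t0 x0 ht0)))
    · refine le_max_of_le_right (hb.trans (mul_le_mul_of_nonneg_right
        ((hgrow l r t (ht0.trans hr.1) hr.2).trans ?_) (add_nonneg hχR hπR)))
      have h1 : (0 : ℝ) ≤ t - r + (nJumps (γ l) r t : ℝ) :=
        add_nonneg (sub_nonneg.2 hr.2) (Nat.cast_nonneg _)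
      exact mul_le_of_le_one_right hK.le (Real.exp_le_one_iff.2 (by nlinarith))
  have hht := hh t (x t) (ht0.trans ht)
  have hA : 0 ≤ K * Real.exp (-(ω * (t - t0 + (nJumps (γ l) t0 t : ℝ)))) * φ2 (h0 t0 x0) :=
    mul_nonneg (by positivity) (hφ2.nonneg (hh0 t0 x0 ht0))
  have hB : 0 ≤ K * (χ R + π R) := mul_nonneg hK.le (add_nonneg hχR hπR)
  have hψle := hψ.2.1.monotoneOn (mem_Ici.2 (hφ1.nonneg hht)) (mem_Ici.2 (le_max_of_le_left hA))
    ((hsand l t (x t) (ht0.trans ht)).1.trans hle)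
  rw [hψφ _ hht] at hψle
  refine hψle.trans ?_
  have hψA := hψ.nonneg hA
  have hψB := hψ.nonneg hB
  rcases max_choice (K * Real.exp (-(ω * (t - t0 + (nJumps (γ l) t0 t : ℝ)))) * φ2 (h0 t0 x0))
    (K * (χ R + π R)) with h | h <;> rw [h]
  · exact le_add_of_nonneg_right hψB
  · exact le_add_of_nonneg_left hψA

end
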